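/- Let f be a nonnegative, radially decreasing function on ℝ^d and let α ∈ (0, d). Then for all r > 0 the Riesz potential satisfies the two-sided pointwise estimate (|·|^{−α} * f)(r) ∼_{d,α} r^{−α} ∫₀^r f(s) s^{d−1} ds + ∫_r^∞ f(s) s^{d−1−α} ds, where the implied constants depend only on d and α and are uniformly bounded for α in any compact subset of (0, d). -/

import Mathlib

open MeasureTheory Metric Set Filter ENNReal
noncomputable section

abbrev Euc (d : ℕ) := EuclideanSpace ℝ (Fin d)

/-- The Riesz potential `(|·|^{-α} * f)(x)`, computed as a lower integral in `ℝ≥0∞`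
so that it is always defined. -/
def rieszPot (d : ℕ) (α : ℝ) (f : Euc d → ℝ) (x : Euc d) : ℝ≥0∞ :=
  ∫⁻ y : Euc d, ENNReal.ofReal (‖x - y‖ ^ (-α)) * ENNReal.ofReal (f y)

/-- The radial majorant `r^{-α} ∫₀^r g(s) s^{d-1} ds + ∫_r^∞ g(s) s^{d-1-α} ds`. -/
def radialBound (d : ℕ) (α : ℝ) (g : ℝ → ℝ) (r : ℝ) : ℝ≥0∞ :=
  ENNReal.ofReal (r ^ (-α)) * (∫⁻ s in Ioc (0 : ℝ) r, ENNReal.ofReal (g s * s ^ ((d : ℝ) - 1)))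
    + ∫⁻ s in Ioi r, ENNReal.ofReal (g s * s ^ ((d : ℝ) - 1 - α))

lemma polar_aux (d : ℕ) (hd : 1 ≤ d) (F : ℝ → ℝ≥0∞) (hF : Measurable F) :
    ∫⁻ x : Euc d, F ‖x‖ = (volume : Measure (Euc d)).toSphere univ *
      ∫⁻ s in Ioi (0 : ℝ), F s * ENNReal.ofReal (s ^ ((d : ℝ) - 1)) := by
  have hnt : Nontrivial (Euc d) := by
    have : Nonempty (Fin d) := ⟨⟨0, hd⟩⟩
    infer_instance
  have hdim : Module.finrank ℝ (Euc d) = d := by simp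
  calc
    ∫⁻ x : Euc d, F ‖x‖ = ∫⁻ x : ({(0)}ᶜ : Set (Euc d)), F (‖x.1‖)
        ∂((volume : Measure (Euc d)).comap (Subtype.val)) := by
      rw [lintegral_subtype_comap (measurableSet_singleton _).compl fun x ↦ F (‖x‖),
        restrict_compl_singleton]
    _ = ∫⁻ x, F x.2 ∂(volume : Measure (Euc d)).toSphere.prod
          (.volumeIoiPow (Module.finrank ℝ (Euc d) - 1)) := by
      have := (volume : Measure (Euc d)).measurePreserving_homeomorphUnitSphereProd.lintegral_comp
        (f := fun p => F p.2) (by fun_prop)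
      simpa using this
    _ = (volume : Measure (Euc d)).toSphere univ * ∫⁻ x : Ioi (0 : ℝ), F x
          ∂.volumeIoiPow (Module.finrank ℝ (Euc d) - 1) := by
      rw [lintegral_prod _ (by fun_prop)]
      simp [mul_comm]
    _ = _ := by
      congr 1
      rw [Measure.volumeIoiPow, lintegral_withDensity_eq_lintegral_mul _ (by fun_prop) (by fun_prop),
        ← lintegral_subtype_comap measurableSet_Ioi
          (fun s => F s * ENNReal.ofReal (s ^ ((d : ℝ) - 1)))]
      refine lintegral_congr fun s => ?_
      rw [hdim, Pi.mul_apply, mul_comm, ← Real.rpow_natCast]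
      push_cast [hd]
      rfl

lemma power_aux (p R : ℝ) (hp : -1 < p) (hR : 0 < R) :
    ∫⁻ s in Ioc (0 : ℝ) R, ENNReal.ofReal (s ^ p) = ENNReal.ofReal (R ^ (p + 1) / (p + 1)) := by
  rw [← ofReal_integral_eq_lintegral_ofReal]
  · rw [← intervalIntegral.integral_of_le hR.le, integral_rpow (Or.inl hp),
      Real.zero_rpow (by linarith), sub_zero]
  · exact (intervalIntegrable_iff_integrableOn_Ioc_of_le hR.le).1
      (intervalIntegral.intervalIntegrable_rpow' hp)
  · filter_upwards [ae_restrict_mem measurableSet_Ioc] with s hs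
    exact Real.rpow_nonneg hs.1.le _

/-- The radial weight comparable with the Riesz kernel. -/
def wt (α r s : ℝ) : ℝ := if s ≤ r then r ^ (-α) else s ^ (-α)

lemma wt_meas (α r : ℝ) : Measurable (wt α r) := by
  unfold wt
  exact Measurable.ite measurableSet_Iic (by fun_prop) (by fun_prop)

lemma wt_int (d : ℕ) (hd : 1 ≤ d) (α : ℝ) (g : ℝ → ℝ) (hg : ∀ s, 0 ≤ g s)
    (hm : Measurable (fun s => g (max s 0))) (r : ℝ) (hr : 0 < r) :
    ∫⁻ y : Euc d, ENNReal.ofReal (wt α r ‖y‖) * ENNReal.ofReal (g ‖y‖) =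
      (volume : Measure (Euc d)).toSphere univ * radialBound d α g r := by
  have h := polar_aux d hd
    (fun s => ENNReal.ofReal (wt α r s) * ENNReal.ofReal (g (max s 0)))
    (((wt_meas α r).ennreal_ofReal).mul hm.ennreal_ofReal)
  simp only [norm_nonneg, max_eq_left] at h
  rw [h]
  congr 1
  rw [← Ioc_union_Ioi_eq_Ioi hr.le, lintegral_union measurableSet_Ioi
    (Set.disjoint_left.2 fun s h1 h2 => not_lt.2 h1.2 h2), radialBound]
  congr 1
  · rw [← lintegral_const_mul' _ _ ENNReal.ofReal_ne_top]
    refine setLIntegral_congr_fun measurableSet_Ioc fun s hs => ?_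
    simp only [wt, if_pos hs.2, max_eq_left hs.1.le]
    rw [ENNReal.ofReal_mul (hg s), mul_assoc]
  · refine setLIntegral_congr_fun measurableSet_Ioi fun s hs => ?_
    have hs' : r < s := hs
    have h0 : 0 < s := hr.trans hs'
    simp only [wt, if_neg (not_le.2 hs'), max_eq_left h0.le]
    rw [← ENNReal.ofReal_mul (by positivity), ← ENNReal.ofReal_mul (mul_nonneg (by positivity) (hg s)),
      show (d : ℝ) - 1 - α = -α + (d - 1) by ring, Real.rpow_add h0]
    congr 1
    ring

lemma wt_lower (d : ℕ) (α : ℝ) (h0 : 0 < α) (h1 : α < d) (x y : Euc d) (hx : x ≠ 0)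
    (hy : y ≠ x) : (2 : ℝ) ^ (-(d : ℝ)) * wt α ‖x‖ ‖y‖ ≤ ‖x - y‖ ^ (-α) := by
  have hxy : 0 < ‖x - y‖ := norm_pos_iff.2 (sub_ne_zero.2 hy.symm)
  have hxp : 0 < ‖x‖ := norm_pos_iff.2 hx
  have key : ∀ m : ℝ, 0 < m → ‖x - y‖ ≤ 2 * m →
      (2 : ℝ) ^ (-(d : ℝ)) * m ^ (-α) ≤ ‖x - y‖ ^ (-α) := fun m hm hle => by
    calc _ ≤ (2 : ℝ) ^ (-α) * m ^ (-α) := by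
          gcongr
          norm_num
      _ = (2 * m) ^ (-α) := (Real.mul_rpow (by norm_num) hm.le).symm
      _ ≤ _ := Real.rpow_le_rpow_of_nonpos hxy hle (by linarith)
  have htri := norm_sub_le x y
  unfold wt
  split_ifs with h
  · exact key _ hxp (by linarith)
  · push Not at h
    exact key _ (hxp.trans h) (by linarith)

lemma wt_upper (d : ℕ) (α : ℝ) (h0 : 0 < α) (h1 : α < d) (x y : Euc d) (hx : x ≠ 0)
    (hy : ‖x‖ / 2 < ‖x - y‖) : ‖x - y‖ ^ (-α) ≤ (3 : ℝ) ^ (d : ℝ) * wt α ‖x‖ ‖y‖ := by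
  have hxp : 0 < ‖x‖ := norm_pos_iff.2 hx
  have key : ∀ m : ℝ, 0 < m → m ≤ 3 * ‖x - y‖ →
      ‖x - y‖ ^ (-α) ≤ (3 : ℝ) ^ (d : ℝ) * m ^ (-α) := fun m hm hle => by
    have h3 : (m / 3) ^ (-α) = 3 ^ α * m ^ (-α) := by
      rw [div_eq_mul_inv, mul_comm, Real.mul_rpow (by norm_num) hm.le,
        Real.inv_rpow (by norm_num), Real.rpow_neg (by norm_num), inv_inv]
    calc _ ≤ (m / 3) ^ (-α) := Real.rpow_le_rpow_of_nonpos (by positivity) (by linarith) (by linarith)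
      _ = 3 ^ α * m ^ (-α) := h3
      _ ≤ _ := by
          gcongr
          norm_num
  have htri : ‖y‖ ≤ ‖x‖ + ‖x - y‖ := by
    have := norm_sub_le x (x - y)
    simpa using this
  unfold wt
  split_ifs with h
  · exact key _ hxp (by linarith)
  · push Not at h
    exact key _ (hxp.trans h) (by linarith)

lemma near_aux (d : ℕ) (hd : 1 ≤ d) (α δ : ℝ) (h0 : 0 < α) (hδ : 0 < δ) (h1 : α + δ ≤ d)
    (g : ℝ → ℝ) (hg : ∀ s, 0 ≤ g s) (ha : AntitoneOn g (Ici (0 : ℝ))) (x : Euc d) (hx : x ≠ 0) :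
    ∫⁻ y : Euc d, ENNReal.ofReal (g (‖x‖ / 2)) *
        (Iic (‖x‖ / 2)).indicator (fun s => ENNReal.ofReal (s ^ (-α))) ‖x - y‖ ≤
      (volume : Measure (Euc d)).toSphere univ *
        (ENNReal.ofReal (d * 2 ^ (d : ℝ) / δ) * radialBound d α g ‖x‖) := by
  have hr : 0 < ‖x‖ := norm_pos_iff.2 hx
  set r := ‖x‖ with hrdef
  have hd0 : (1 : ℝ) ≤ d := by exact_mod_cast hd
  rw [lintegral_const_mul' _ _ ENNReal.ofReal_ne_top,
    lintegral_sub_left_eq_self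
      (fun z : Euc d => (Iic (r / 2)).indicator (fun s => ENNReal.ofReal (s ^ (-α))) ‖z‖) x,
    polar_aux d hd (fun s => (Iic (r / 2)).indicator (fun s => ENNReal.ofReal (s ^ (-α))) s)
      (Measurable.indicator (by fun_prop) measurableSet_Iic), mul_left_comm]
  refine mul_le_mul_right ?_ _
  have e1 : ∫⁻ s in Ioi (0 : ℝ), (Iic (r / 2)).indicator (fun s => ENNReal.ofReal (s ^ (-α))) s *
      ENNReal.ofReal (s ^ ((d : ℝ) - 1)) = ∫⁻ s in Ioc 0 (r / 2), ENNReal.ofReal (s ^ ((d : ℝ) - 1 - α)) := by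
    rw [← Ioi_inter_Iic, inter_comm, ← Measure.restrict_restrict measurableSet_Iic,
      ← lintegral_indicator measurableSet_Iic]
    refine setLIntegral_congr_fun measurableSet_Ioi fun s hs => ?_
    have hs' : 0 < s := hs
    by_cases h : s ∈ Iic (r / 2)
    · simp only [indicator_of_mem h]
      rw [← ENNReal.ofReal_mul (by positivity), ← Real.rpow_add hs']
      congr 2
      ring
    · simp only [indicator_of_notMem h, zero_mul]
  rw [e1, power_aux _ _ (by linarith) (by positivity)]
  have e2 : ENNReal.ofReal (g (r / 2)) * ENNReal.ofReal ((r / 2) ^ (d : ℝ) / d) ≤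
      ∫⁻ s in Ioc (0 : ℝ) r, ENNReal.ofReal (g s * s ^ ((d : ℝ) - 1)) := by
    have := power_aux ((d : ℝ) - 1) (r / 2) (by linarith) (by positivity)
    rw [sub_add_cancel] at this
    rw [← this, ← lintegral_const_mul' _ _ ENNReal.ofReal_ne_top]
    refine le_trans ?_ (lintegral_mono_set (Ioc_subset_Ioc_right (by linarith : r / 2 ≤ r)))
    refine setLIntegral_mono' measurableSet_Ioc fun s hs => ?_
    rw [← ENNReal.ofReal_mul (hg _)]
    refine ENNReal.ofReal_le_ofReal (mul_le_mul_of_nonneg_right ?_ (Real.rpow_nonneg hs.1.le _))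
    exact ha hs.1.le (mem_Ici.2 (by positivity)) hs.2
  have e3 : (r / 2) ^ ((d : ℝ) - 1 - α + 1) / ((d : ℝ) - 1 - α + 1) ≤
      (d * 2 ^ (d : ℝ) / δ) * (r ^ (-α) * ((r / 2) ^ (d : ℝ) / d)) := by
    have a1 : (r / 2) ^ ((d : ℝ) - 1 - α + 1) = 2 ^ α * (r ^ (-α) * (r / 2) ^ (d : ℝ)) := by
      rw [show (d : ℝ) - 1 - α + 1 = -α + d by ring, Real.rpow_add (by positivity),
        div_eq_mul_inv, Real.mul_rpow (x := r) (z := -α) hr.le (by norm_num),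
        Real.inv_rpow (by norm_num), Real.rpow_neg (x := 2) (by norm_num), inv_inv]
      ring
    have a2 : (2 : ℝ) ^ α ≤ 2 ^ (d : ℝ) := Real.rpow_le_rpow_of_exponent_le (by norm_num) (by linarith)
    rw [a1]
    calc _ ≤ 2 ^ (d : ℝ) * (r ^ (-α) * (r / 2) ^ (d : ℝ)) / δ := by
          gcongr
          linarith
      _ = _ := by field_simp
  calc _ ≤ ENNReal.ofReal (g (r / 2)) *
        ENNReal.ofReal ((d * 2 ^ (d : ℝ) / δ) * (r ^ (-α) * ((r / 2) ^ (d : ℝ) / d))) := by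
        gcongr
    _ = ENNReal.ofReal (d * 2 ^ (d : ℝ) / δ) * (ENNReal.ofReal (r ^ (-α)) *
        (ENNReal.ofReal (g (r / 2)) * ENNReal.ofReal ((r / 2) ^ (d : ℝ) / d))) := by
        rw [ENNReal.ofReal_mul (by positivity), ENNReal.ofReal_mul (by positivity)]
        ring
    _ ≤ _ := by
        unfold radialBound
        gcongr
        exact le_trans (by gcongr) le_self_add

theorem stmt5 (d : ℕ) (hd : 1 ≤ d) (K : Set ℝ) (hK : IsCompact K) (hK' : K ⊆ Ioo (0 : ℝ) (d : ℝ)) :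
    ∃ c C : ℝ, 0 < c ∧ 0 < C ∧
      ∀ α ∈ K, ∀ f : Euc d → ℝ, ∀ g : ℝ → ℝ,
        (∀ s, 0 ≤ g s) → AntitoneOn g (Ici (0 : ℝ)) → (∀ x : Euc d, f x = g ‖x‖) →
        ∀ x : Euc d, x ≠ 0 →
          ENNReal.ofReal c * radialBound d α g ‖x‖ ≤ rieszPot d α f x ∧
          rieszPot d α f x ≤ ENNReal.ofReal C * radialBound d α g ‖x‖ := by
  have hd0 : (1 : ℝ) ≤ d := by exact_mod_cast hd
  obtain ⟨δ, hδ, hKδ⟩ : ∃ δ : ℝ, 0 < δ ∧ ∀ α ∈ K, α + δ ≤ d := by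
    rcases K.eq_empty_or_nonempty with rfl | hne
    · exact ⟨1, one_pos, by simp⟩
    · obtain ⟨a, ha, hmax⟩ := hK.exists_isMaxOn hne continuousOn_id
      refine ⟨d - a, sub_pos.2 (hK' ha).2, fun α hα => ?_⟩
      have : α ≤ a := hmax hα
      linarith
  have hnt : Nontrivial (Euc d) := by
    have : Nonempty (Fin d) := ⟨⟨0, hd⟩⟩
    infer_instance
  set σ := (volume : Measure (Euc d)).toSphere univ with hσ
  have hσt : σ ≠ ⊤ := measure_ne_top _ _
  have hσ0 : σ ≠ 0 := by
    rw [hσ, Measure.toSphere_apply_univ]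
    refine mul_ne_zero ?_ (measure_ball_pos _ _ one_pos).ne'
    simp
    omega
  have hσp : 0 < σ.toReal := ENNReal.toReal_pos hσ0 hσt
  refine ⟨σ.toReal * 2 ^ (-(d : ℝ)), σ.toReal * (3 ^ (d : ℝ) + d * 2 ^ (d : ℝ) / δ),
    by positivity, by positivity, ?_⟩
  intro α hα f g hg ha hf x hx
  have h0 := (hK' hα).1
  have h1 := (hK' hα).2
  have hr : 0 < ‖x‖ := norm_pos_iff.2 hx
  have hm : Measurable (fun s => g (max s 0)) := by
    apply Antitone.measurable
    intro s t hst
    exact ha (mem_Ici.2 (le_max_right _ _)) (mem_Ici.2 (le_max_right _ _)) (max_le_max_right _ hst)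
  have hW := wt_int d hd α g hg hm ‖x‖ hr
  rw [ENNReal.ofReal_mul hσp.le, ENNReal.ofReal_mul hσp.le, ENNReal.ofReal_toReal hσt]
  constructor
  · rw [mul_comm σ, mul_assoc, ← hW, ← lintegral_const_mul' _ _ ENNReal.ofReal_ne_top, rieszPot]
    refine lintegral_mono_ae ?_
    filter_upwards [compl_mem_ae_iff.2 (measure_singleton x)] with y hy
    rw [← mul_assoc, ← ENNReal.ofReal_mul (by positivity), hf]
    gcongr
    exact wt_lower d α h0 h1 x y hx hy
  · have hpt : ∀ y : Euc d, ENNReal.ofReal (‖x - y‖ ^ (-α)) * ENNReal.ofReal (f y) ≤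
        ENNReal.ofReal (3 ^ (d : ℝ)) * (ENNReal.ofReal (wt α ‖x‖ ‖y‖) * ENNReal.ofReal (g ‖y‖)) +
        ENNReal.ofReal (g (‖x‖ / 2)) *
          (Iic (‖x‖ / 2)).indicator (fun s => ENNReal.ofReal (s ^ (-α))) ‖x - y‖ := by
      intro y
      rw [hf]
      by_cases h : ‖x - y‖ ∈ Iic (‖x‖ / 2)
      · refine le_trans ?_ le_add_self
        rw [indicator_of_mem h, mul_comm]
        gcongr
        refine ha (mem_Ici.2 (by positivity)) (by simp) ?_
        have := norm_sub_norm_le x y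
        have h' : ‖x - y‖ ≤ ‖x‖ / 2 := h
        linarith
      · refine le_trans ?_ le_self_add
        rw [← mul_assoc, ← ENNReal.ofReal_mul (p := 3 ^ (d : ℝ)) (by positivity)]
        gcongr
        exact wt_upper d α h0 h1 x y hx (not_le.1 h)
    have hmeas : Measurable fun y : Euc d => ENNReal.ofReal (3 ^ (d : ℝ)) *
        (ENNReal.ofReal (wt α ‖x‖ ‖y‖) * ENNReal.ofReal (g ‖y‖)) := by
      have h2 : Measurable fun y : Euc d => g ‖y‖ := by
        have := hm.comp (measurable_norm (α := Euc d))
        simpa [Function.comp_def] using this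
      have h3 : Measurable fun y : Euc d => wt α ‖x‖ ‖y‖ := (wt_meas α ‖x‖).comp measurable_norm
      exact (h3.ennreal_ofReal.mul h2.ennreal_ofReal).const_mul _
    refine (lintegral_mono hpt).trans ?_
    rw [lintegral_add_left hmeas, lintegral_const_mul' _ _ ENNReal.ofReal_ne_top, hW]
    refine (add_le_add le_rfl (near_aux d hd α δ h0 hδ (hKδ α hα) g hg ha x hx)).trans ?_
    rw [ENNReal.ofReal_add (by positivity) (by positivity)]
    apply le_of_eq
    ring
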